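/- For every integer k ≥ 2, the k-th prime satisfies p_k ≤ k^{log 3 / log 2}. -/

import Mathlib

/-- The i-th prime number, with `nthPrime 1 = 2`, `nthPrime 2 = 3`, etc. -/
noncomputable def nthPrime (i : ℕ) : ℕ := Nat.nth Nat.Prime (i - 1)

/-- A number `1 < m < (n + 1) ^ 2` coprime to all primes up to `n` is prime. -/
theorem Nat.prime_of_coprime_primorial {m n : ℕ} (hm : 1 < m) (hmn : m < (n + 1) ^ 2)
    (h : Nat.Coprime m (primorial n)) : m.Prime := by
  by_contra hp
  have hq : m.minFac.Prime := Nat.minFac_prime hm.ne'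
  have hlt : m.minFac < n + 1 :=
    lt_of_pow_lt_pow_left₀ 2 (by omega) ((Nat.minFac_sq_le_self (by omega) hp).trans_lt hmn)
  exact hq.one_lt.ne' (Nat.eq_one_of_dvd_coprimes h (Nat.minFac_dvd m)
    (hq.dvd_primorial_iff.2 (by omega)))

/-- A lower bound for the prime counting function, obtained by sieving out the primes up to `31`;
here `200560490130` is the product of these primes. -/
theorem Nat.count_sieve_le_primeCounting (n : ℕ) :
    Nat.count (fun m ↦ (1 < m ∧ m < 1024 ∧ m.gcd 200560490130 = 1) ∨
      m ∈ [2, 3, 5, 7, 11, 13, 17, 19, 23, 29, 31]) (n + 1) ≤ Nat.primeCounting n := by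
  refine Nat.count_mono_left fun m _ hm ↦ ?_
  rcases hm with ⟨h1, h2, h3⟩ | hm
  · have hP : primorial 31 = 200560490130 := by decide +kernel
    exact Nat.prime_of_coprime_primorial (n := 31) h1 h2 (by rwa [hP])
  · simp only [List.mem_cons, List.not_mem_nil, or_false] at hm
    rcases hm with rfl | rfl | rfl | rfl | rfl | rfl | rfl | rfl | rfl | rfl | rfl <;> norm_num

/-- An explicit Chebyshev-type lower bound: `p ^ (2 / 3) ≤ π p` for `p ≥ 1331`. -/
theorem sq_le_primeCounting_cube_of_large {p : ℕ} (hp : 1331 ≤ p) :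
    p ^ 2 ≤ Nat.primeCounting p ^ 3 := by
  by_contra! hlt
  have hp' : (1331 : ℝ) ≤ p := by exact_mod_cast hp
  set k : ℝ := (Nat.primeCounting p : ℝ) with hk
  have hlt' : k ^ 3 < (p : ℝ) ^ 2 := by rw [hk]; exact_mod_cast hlt
  obtain ⟨y, hy0, hy⟩ : ∃ y : ℝ, 0 ≤ y ∧ y ^ 3 = p :=
    ⟨(p : ℝ) ^ ((1 : ℝ) / 3), by positivity, by
      rw [← Real.rpow_natCast, ← Real.rpow_mul (by positivity)]; norm_num⟩
  have hy11 : 11 ≤ y := by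
    by_contra! h
    have : y ^ 3 < 11 ^ 3 := pow_lt_pow_left₀ h hy0 (by norm_num)
    linarith
  have hky : k ≤ y ^ 2 := by
    by_contra! h
    have : (y ^ 2) ^ 3 < k ^ 3 := pow_lt_pow_left₀ h (by positivity) (by norm_num)
    rw [← hy] at hlt'
    nlinarith
  have hlog : Real.log y ≤ 3 * Real.log 2 + y / 8 - 1 := by
    have h1 := Real.log_le_sub_one_of_pos (show 0 < y / 8 by positivity)
    rw [Real.log_div (by positivity) (by norm_num), show (8 : ℝ) = 2 ^ 3 by norm_num,
      Real.log_pow] at h1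
    norm_num at h1 ⊢
    linarith
  have hlogp : Real.log p = 3 * Real.log y := by rw [← hy, Real.log_pow]; norm_num
  have hlogp1 : Real.log (p + 1) ≤ 3 * Real.log y + 1 := by
    have h1 : Real.log ((p + 1) / p) ≤ (p + 1) / p - 1 :=
      Real.log_le_sub_one_of_pos (by positivity)
    rw [Real.log_div (by positivity) (by positivity), hlogp] at h1
    have h2 : ((p : ℝ) + 1) / p ≤ 2 := by rw [div_le_iff₀ (by positivity)]; linarith
    linarith
  have hpi := Chebyshev.pi_ge p
  have hlogy : 0 < Real.log y := Real.log_pos (by linarith)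
  rw [hlogp, div_le_iff₀ (by positivity), ← hk] at hpi
  have hmul : k * (3 * Real.log y) ≤ y ^ 2 * (3 * (1.0796 + y / 8)) :=
    mul_le_mul hky (by linarith [Real.log_two_lt_d9]) (by positivity) (by positivity)
  have hmain : y ^ 3 * 0.693 ≤ p * Real.log 2 := by
    rw [hy]
    exact mul_le_mul_of_nonneg_left (by linarith [Real.log_two_gt_d9]) (by positivity)
  nlinarith [Real.log_two_lt_d9, mul_nonneg (sq_nonneg y) (sub_nonneg.2 hy11),
    mul_nonneg hy0 (sub_nonneg.2 hy11)]

/-- For primes `p ≥ 5` one has `p ^ (2 / 3) ≤ π p`. -/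
theorem Nat.Prime.sq_le_primeCounting_cube {p : ℕ} (hp : p.Prime) (hp5 : 5 ≤ p) :
    p ^ 2 ≤ Nat.primeCounting p ^ 3 := by
  have step (a c b : ℕ) (hc : c ≤ Nat.primeCounting a) (hcb : b ^ 2 ≤ c ^ 3) (ha : a ≤ p)
      (hb : p ≤ b) : p ^ 2 ≤ Nat.primeCounting p ^ 3 :=
    (Nat.pow_le_pow_left hb 2).trans
      (hcb.trans (Nat.pow_le_pow_left (hc.trans (Nat.monotone_primeCounting ha)) 3))
  have sieve {a c : ℕ} (h : c ≤ _) : c ≤ Nat.primeCounting a :=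
    h.trans (Nat.count_sieve_le_primeCounting a)
  rcases Nat.lt_or_ge p 67 with h67 | h67
  · clear step sieve
    interval_cases p <;> first | decide +kernel | exact absurd hp (by norm_num)
  rcases Nat.le_total p 82 with h82 | h82
  · exact step 67 19 82 (sieve (by decide +kernel)) (by norm_num) h67 h82
  rcases Nat.le_total p 103 with h103 | h103
  · exact step 82 22 103 (sieve (by decide +kernel)) (by norm_num) h82 h103
  rcases Nat.le_total p 140 with h140 | h140
  · exact step 103 27 140 (sieve (by decide +kernel)) (by norm_num) h103 h140
  rcases Nat.le_total p 198 with h198 | h198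
  · exact step 140 34 198 (sieve (by decide +kernel)) (by norm_num) h140 h198
  rcases Nat.le_total p 301 with h301 | h301
  · exact step 198 45 301 (sieve (by decide +kernel)) (by norm_num) h198 h301
  rcases Nat.le_total p 488 with h488 | h488
  · exact step 301 62 488 (sieve (by decide +kernel)) (by norm_num) h301 h488
  rcases Nat.le_total p 896 with h896 | h896
  · exact step 488 93 896 (sieve (by decide +kernel)) (by norm_num) h488 h896
  rcases Nat.le_total p 1331 with h1331 | h1331
  · exact step 896 154 1331 (sieve (by decide +kernel)) (by norm_num) h896 h1331
  exact sq_le_primeCounting_cube_of_large h1331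

/-- For every integer k ≥ 2, the k-th prime satisfies p_k ≤ k^{log 3 / log 2}. -/
theorem nthPrime_le_rpow (k : ℕ) (hk : 2 ≤ k) :
    (nthPrime k : ℝ) ≤ (k : ℝ) ^ (Real.log 3 / Real.log 2) := by
  have hlog2 : 0 < Real.log 2 := Real.log_pos (by norm_num)
  rcases hk.eq_or_lt with rfl | hk3
  · have h : (2 : ℝ) ^ (Real.log 3 / Real.log 2) = 3 :=
      Real.rpow_logb (by norm_num) (by norm_num) (by norm_num)
    rw [nthPrime, Nat.nth_prime_one_eq_three]
    exact_mod_cast h.ge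
  have hprime : (nthPrime k).Prime := Nat.prime_nth_prime _
  have hpi : Nat.primeCounting (nthPrime k) = k := by
    rw [nthPrime, Nat.primeCounting, Nat.primeCounting',
      Nat.count_nth_succ_of_infinite Nat.infinite_setOfPred_prime]
    omega
  have h5 : 5 ≤ nthPrime k := by
    rw [← Nat.nth_prime_two_eq_five]
    exact Nat.nth_monotone Nat.infinite_setOfPred_prime (by omega)
  have hsq := hprime.sq_le_primeCounting_cube h5
  rw [hpi] at hsq
  have hexp : (3 / 2 : ℝ) ≤ Real.log 3 / Real.log 2 := by
    rw [div_le_div_iff₀ (by norm_num) hlog2]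
    have h := Real.log_le_log (by norm_num) (show (2 : ℝ) ^ 3 ≤ 3 ^ 2 by norm_num)
    rw [Real.log_pow, Real.log_pow] at h
    norm_num at h
    linarith
  calc (nthPrime k : ℝ) ≤ (k : ℝ) ^ (3 / 2 : ℝ) := by
        refine le_of_sq_le_sq ?_ (by positivity)
        rw [← Real.rpow_natCast ((k : ℝ) ^ (3 / 2 : ℝ)), ← Real.rpow_mul (by positivity)]
        norm_num
        exact_mod_cast hsq
    _ ≤ _ := Real.rpow_le_rpow_of_exponent_le (by exact_mod_cast (by omega : 1 ≤ k)) hexp
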